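/- Let π' = (d'₁,…,d'_n) and π'' = (d''₁,…,d''_n) be two non-increasing tree degree sequences with π' ◁ π''. Then ξ^{ce}(T*_{π'}) ≤ ξ^{ce}(T*_{π''}), where T*_π denotes the greedy tree for the degree sequence π. -/

import Mathlib

open Finset SimpleGraph

variable {V : Type*}

open Classical in
/-- The degree of a vertex `u` in a graph `G` (number of neighbors). -/
noncomputable def deg [Fintype V] (G : SimpleGraph V) (u : V) : ℕ :=
  (Finset.univ.filter (fun v => G.Adj u v)).card

/-- The eccentricity of a vertex `u`: the maximum distance from `u` to any vertex. -/
noncomputable def ecc [Fintype V] (G : SimpleGraph V) (u : V) : ℕ :=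
  Finset.univ.sup (fun v => G.dist u v)

/-- The connective eccentricity index `ξ^{ce}(G) = Σ_{u ∈ V} d(u)/ε(u)`. -/
noncomputable def cei [Fintype V] (G : SimpleGraph V) : ℝ :=
  ∑ u : V, (deg G u : ℝ) / (ecc G u)

/-- `d` is a non-increasing tree degree sequence: positive entries, non-increasing,
summing to `2(n-1)`. -/
def IsTreeDegSeq {n : ℕ} (d : Fin n → ℕ) : Prop :=
  (∀ i, 1 ≤ d i) ∧ (∀ i j : Fin n, i ≤ j → d j ≤ d i) ∧ ∑ i, d i = 2 * (n - 1)

/-- `b` majorizes `a` (written `a ◁ b`): every proper prefix sum of `a` is at most the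
corresponding prefix sum of `b`, and the total sums agree. -/
def Maj {n : ℕ} (a b : Fin n → ℕ) : Prop :=
  (∀ k : ℕ, k < n →
    ∑ i ∈ Finset.univ.filter (fun i : Fin n => (i : ℕ) < k), a i ≤
      ∑ i ∈ Finset.univ.filter (fun i : Fin n => (i : ℕ) < k), b i) ∧
  ∑ i, a i = ∑ i, b i

/-- `G` has degree sequence `d = (d₁, …, d_n)` (up to relabeling of the vertices). -/
def hasDegSeq [Fintype V] (G : SimpleGraph V) {n : ℕ} (d : Fin n → ℕ) : Prop :=
  ∃ e : V ≃ Fin n, ∀ v, deg G v = d (e v)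

/-- The rooted tree `(T, r)` has level-degree sequence `L`: for each `i`, `L i` is the
multiset of degrees of the vertices at height (distance from the root) `i`. -/
def hasLevelDegSeq [Fintype V] (T : SimpleGraph V) (r : V) (L : ℕ → Multiset ℕ) : Prop :=
  ∀ i : ℕ, L i = ((Finset.univ.filter (fun v => T.dist r v = i)).val.map (deg T))

/-- The rooted tree `(T, r)` is level-greedy: there is a left-to-right ordering `ord`
of the vertices of each level such that within every level the degrees are
non-increasing from left to right, and each vertex of a level joins its children to
the first so-far-unconnected vertices of the next level, i.e. the children of an
earlier vertex come before the children of a later vertex. -/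
def IsLevelGreedy [Fintype V] (T : SimpleGraph V) (r : V) : Prop :=
  ∃ ord : V → ℕ,
    (∀ u v, T.dist r u = T.dist r v → ord u = ord v → u = v) ∧
    (∀ u v, T.dist r u = T.dist r v → ord u ≤ ord v → deg T v ≤ deg T u) ∧
    (∀ p q u v, T.dist r u = T.dist r v →
      T.Adj p u → T.dist r u = T.dist r p + 1 →
      T.Adj q v → T.dist r v = T.dist r q + 1 →
      ord p < ord q → ord u < ord v)

/-- The rooted tree `(T, r)` is the greedy tree for its degree sequence: it is
level-greedy, the root has maximal degree, and every degree occurring at height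
`i + 1` is at most every degree occurring at height `i`. -/
def IsGreedyTree [Fintype V] (T : SimpleGraph V) (r : V) : Prop :=
  IsLevelGreedy T r ∧ (∀ v, deg T v ≤ deg T r) ∧
    (∀ u v : V, T.dist r u = T.dist r v + 1 → deg T u ≤ deg T v)

/-- In a tree, a vertex has at most one neighbor closer to a given root. -/
lemma parent_unique {T : SimpleGraph V} (hT : T.IsTree) {r u p q : V}
    (hp : T.Adj p u) (hpd : T.dist r u = T.dist r p + 1)
    (hq : T.Adj q u) (hqd : T.dist r u = T.dist r q + 1) : p = q := by
  obtain ⟨P, hP⟩ := hT.connected.exists_walk_length_eq_dist r p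
  obtain ⟨Q, hQ⟩ := hT.connected.exists_walk_length_eq_dist r q
  have hP' : (P.concat hp).IsPath :=
    Walk.isPath_of_length_eq_dist _ (by rw [Walk.length_concat, hP, hpd])
  have hQ' : (Q.concat hq).IsPath :=
    Walk.isPath_of_length_eq_dist _ (by rw [Walk.length_concat, hQ, hqd])
  have h := (hT.existsUnique_path r u).unique hP' hQ'
  have h' := congrArg Walk.penultimate h
  simpa using h'

/-- A vertex other than the root has a neighbor closer to the root. -/
lemma exists_parent {T : SimpleGraph V} (hT : T.Connected) {r u : V} (h : u ≠ r) :
    ∃ p, T.Adj p u ∧ T.dist r u = T.dist r p + 1 := by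
  obtain ⟨P, hP⟩ := hT.exists_walk_length_eq_dist u r
  cases P with
  | nil => exact absurd rfl h
  | @cons _ p _ hadj P =>
    refine ⟨p, hadj.symm, ?_⟩
    rw [Walk.length_cons] at hP
    have h1 := dist_le P
    have h2 := hT.dist_triangle (u := u) (v := p) (w := r)
    rw [dist_eq_one_iff_adj.mpr hadj] at h2
    rw [dist_comm, dist_comm (u := r)]
    omega

/-- If an edge `c e` of a tree separates `u` from `y`, it lies on the geodesic between them. -/
lemma dist_across_edge {T : SimpleGraph V} (hT : T.IsTree) {c e u : V} (hce : T.Adj c e)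
    (hu : T.dist u c = T.dist u e + 1) (y : V) (hy : T.dist y e = T.dist y c + 1) :
    T.dist u y = T.dist u e + 1 + T.dist c y := by
  induction hk : T.dist c y using Nat.strong_induction_on generalizing y with
  | _ k ih =>
  have hsplit : ∀ {a b w}, T.Adj a b →
      T.dist w a = T.dist w b + 1 ∨ T.dist w b = T.dist w a + 1 := by
    intro a b w hab
    have := hT.dist_eq_dist_add_one_of_adj w hab
    omega
  have step : ∀ {q y}, T.dist y e = T.dist y c + 1 → T.Adj q y →
      T.dist c y = T.dist c q + 1 → T.dist q e = T.dist q c + 1 := by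
    intro q y hy hqy hd
    rcases hsplit (w := q) hce with h | h
    · have := hT.connected.dist_triangle (u := y) (v := q) (w := e)
      rw [dist_eq_one_iff_adj.mpr hqy.symm] at this
      rw [dist_comm (u := c) (v := y), dist_comm (u := c) (v := q)] at hd
      omega
    · exact h
  by_cases hyc : y = c
  · subst hyc; simp at hk; omega
  obtain ⟨q, hqy, hqd⟩ := exists_parent hT.connected hyc
  have hq := step hy hqy hqd
  have hqu := ih (T.dist c q) (by omega) q hq rfl
  rcases hsplit (w := u) hqy with h | h
  · exfalso
    by_cases hqc : q = c
    · subst hqc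
      have : y = e := parent_unique hT hqy.symm h hce.symm hu
      subst this
      simp at hy
    · obtain ⟨z, hzq, hzd⟩ := exists_parent hT.connected hqc
      have hz := step hq hzq hzd
      have hzu := ih (T.dist c z) (by omega) z hz rfl
      have : y = z := parent_unique hT hqy.symm h hzq (by omega)
      subst this
      omega
  · omega

/-- The vertices at distance at most `i` from `c` or from `e`. -/
noncomputable def pairBall [Fintype V] (T : SimpleGraph V) (c e : V) (i : ℕ) : Finset V :=
  Finset.univ.filter (fun u => T.dist c u ≤ i ∨ T.dist e u ≤ i)

lemma mem_pairBall [Fintype V] {T : SimpleGraph V} {c e u : V} {i : ℕ} :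
    u ∈ pairBall T c e i ↔ T.dist c u ≤ i ∨ T.dist e u ≤ i := by
  simp [pairBall]

lemma pairBall_succ_iff [Fintype V] {T : SimpleGraph V} (hT : T.Connected) {c e u : V} {i : ℕ} :
    u ∈ pairBall T c e (i + 1) ↔
      u ∈ pairBall T c e i ∨ ∃ p ∈ pairBall T c e i, T.Adj p u := by
  have key : ∀ a, T.dist a u ≤ i + 1 → T.dist a u ≤ i ∨ ∃ p, T.dist a p ≤ i ∧ T.Adj p u := by
    intro a ha
    by_cases h : u = a
    · subst h; simp
    · obtain ⟨p, hp, hd⟩ := exists_parent hT h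
      exact Or.inr ⟨p, by omega, hp⟩
  have key' : ∀ a p, T.Adj p u → T.dist a p ≤ i → T.dist a u ≤ i + 1 := by
    intro a p hp hd
    have := hT.dist_triangle (u := a) (v := p) (w := u)
    rw [dist_eq_one_iff_adj.mpr hp] at this
    omega
  simp only [mem_pairBall]
  constructor
  · rintro (h | h)
    · rcases key _ h with h | ⟨p, h1, h2⟩
      · exact Or.inl (Or.inl h)
      · exact Or.inr ⟨p, Or.inl h1, h2⟩
    · rcases key _ h with h | ⟨p, h1, h2⟩
      · exact Or.inl (Or.inr h)
      · exact Or.inr ⟨p, Or.inr h1, h2⟩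
  · rintro ((h | h) | ⟨p, h | h, hp⟩)
    · exact Or.inl (by omega)
    · exact Or.inr (by omega)
    · exact Or.inl (key' _ _ hp h)
    · exact Or.inr (key' _ _ hp h)

/-- The ball around a vertex or an edge of a tree contains, with any vertex, its parent. -/
lemma parent_mem_pairBall [Fintype V] {T : SimpleGraph V} (hT : T.IsTree) {c e : V}
    (hce : c = e ∨ T.Adj c e) {i : ℕ} {u p : V} (hu : u ∈ pairBall T c e i)
    (hp : T.Adj p u) (hd : T.dist c u = T.dist c p + 1) : p ∈ pairBall T c e i := by
  rw [mem_pairBall] at hu ⊢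
  rcases hce with rfl | hce
  · omega
  rcases hu with hu | hu
  · omega
  by_cases hue : u = e
  · subst hue
    have := dist_eq_one_iff_adj.mpr hce
    have : T.dist c p = 0 := by omega
    omega
  obtain ⟨q, hq, hqd⟩ := exists_parent hT.connected hue
  have h1 := hT.dist_eq_dist_add_one_of_adj u hce
  have h2 := hT.connected.dist_triangle (u := c) (v := e) (w := q)
  have h3 := hT.connected.dist_triangle (u := c) (v := q) (w := u)
  rw [dist_eq_one_iff_adj.mpr hce] at h2
  rw [dist_eq_one_iff_adj.mpr hq] at h3
  rw [dist_comm (u := u) (v := c), dist_comm (u := u) (v := e)] at h1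
  rcases h1 with h1 | h1
  · have : p = q := parent_unique hT hp hd hq (by omega)
    subst this
    omega
  · omega

/-- Counting edges incident to the ball around a vertex or an edge of a tree. -/
lemma card_pairBall_succ [Fintype V] {T : SimpleGraph V} (hT : T.IsTree) {c e : V}
    (hce : c = e ∨ T.Adj c e) (i : ℕ) :
    (pairBall T c e (i + 1)).card + (pairBall T c e i).card =
      2 + ∑ u ∈ pairBall T c e i, deg T u := by
  classical
  set S := pairBall T c e i with hS
  have hcS : c ∈ S := by simp [hS, mem_pairBall]
  have hpar : ∀ u, ∃ p, u ≠ c → T.Adj p u ∧ T.dist c u = T.dist c p + 1 := by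
    intro u
    by_cases h : u = c
    · exact ⟨u, fun h' => absurd h h'⟩
    · obtain ⟨p, hp⟩ := exists_parent hT.connected h
      exact ⟨p, fun _ => hp⟩
  choose par hpar using hpar
  have hdeg : ∀ u, deg T u =
      (univ.filter (fun w => w ≠ c ∧ par w = u)).card + if u = c then 0 else 1 := by
    intro u
    have hsub : univ.filter (fun v => T.Adj u v) =
        univ.filter (fun w => w ≠ c ∧ par w = u) ∪ (if u = c then ∅ else {par u}) := by
      ext w
      simp only [mem_filter, mem_univ, true_and, mem_union]
      constructor
      · intro huw
        have h1 := hT.dist_eq_dist_add_one_of_adj c huw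
        rcases h1 with h1 | h1
        · right
          have huc : u ≠ c := by rintro rfl; simp at h1
          rw [if_neg huc, mem_singleton]
          exact parent_unique hT huw.symm h1 (hpar u huc).1 (hpar u huc).2
        · left
          have hwc : w ≠ c := by rintro rfl; simp at h1
          exact ⟨hwc, parent_unique hT (hpar w hwc).1 (hpar w hwc).2 huw h1⟩
      · rintro (⟨hwc, rfl⟩ | h)
        · exact (hpar w hwc).1
        · split_ifs at h with huc
          · simp at h
          · rw [mem_singleton] at h
            subst h
            exact (hpar u huc).1.symm
    unfold deg
    have hcongr : (univ.filter (fun v => T.Adj u v)).card =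
      (univ.filter (fun w => w ≠ c ∧ par w = u)).card + if u = c then 0 else 1 := by
      rw [hsub, card_union_of_disjoint]
      · split_ifs <;> simp
      · rw [Finset.disjoint_left]
        intro w hw hw'
        simp only [mem_filter, mem_univ, true_and] at hw
        split_ifs at hw' with huc
        · simp at hw'
        · rw [mem_singleton] at hw'
          have h1 := (hpar w hw.1).2
          have h2 := (hpar u huc).2
          rw [hw.2] at h1
          rw [← hw'] at h2
          omega
    convert hcongr
  have hchild : univ.filter (fun w => w ≠ c ∧ par w ∈ S) = (pairBall T c e (i + 1)).erase c := by
    ext w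
    simp only [mem_filter, mem_univ, true_and, mem_erase, pairBall_succ_iff hT.connected, ← hS]
    refine and_congr_right fun hwc => ⟨fun h => Or.inr ⟨_, h, (hpar w hwc).1⟩, ?_⟩
    have hclosed : w ∈ S → par w ∈ S := fun h =>
      parent_mem_pairBall hT hce h (hpar w hwc).1 (hpar w hwc).2
    rintro (h | ⟨p, hp, hadj⟩)
    · exact hclosed h
    · rcases hT.dist_eq_dist_add_one_of_adj c hadj with h | h
      · exact hclosed (parent_mem_pairBall hT hce hp hadj.symm h)
      · rwa [parent_unique hT (hpar w hwc).1 (hpar w hwc).2 hadj h]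
  have hsum1 : ∑ u ∈ S, (univ.filter (fun w => w ≠ c ∧ par w = u)).card =
      (univ.filter (fun w => w ≠ c ∧ par w ∈ S)).card := by
    rw [card_eq_sum_card_fiberwise (f := par) (t := S)]
    · refine sum_congr rfl fun u hu => ?_
      congr 1
      ext w
      simp only [mem_filter, mem_univ, true_and]
      constructor
      · rintro ⟨h1, rfl⟩; exact ⟨⟨h1, hu⟩, rfl⟩
      · rintro ⟨⟨h1, _⟩, rfl⟩; exact ⟨h1, rfl⟩
    · intro w hw
      simp at hw
      exact hw.2
  have hsum2 : ∑ u ∈ S, (if u = c then 0 else 1) = S.card - 1 := by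
    rw [← card_erase_of_mem hcS, card_eq_sum_ones, ← filter_ne', sum_filter]
    exact sum_congr rfl fun u _ => by by_cases h : u = c <;> simp [h]
  have hc1 : c ∈ pairBall T c e (i + 1) := by simp [mem_pairBall]
  rw [sum_congr rfl fun u _ => hdeg u, sum_add_distrib, hsum1, hsum2, hchild,
    card_erase_of_mem hc1]
  have := card_pos.mpr ⟨c, hcS⟩
  have := card_pos.mpr ⟨c, hc1⟩
  omega

/-- A set consisting of largest values of `f` maximizes the sum of `f`. -/
lemma sum_le_sum_of_dominating {α : Type*} (f : α → ℕ) (S I : Finset α) (hcard : S.card ≤ I.card)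
    (h : ∀ u ∈ I, ∀ v, v ∉ I → f v ≤ f u) : ∑ u ∈ S, f u ≤ ∑ u ∈ I, f u := by
  classical
  have hc : (S \ I).card ≤ (I \ S).card := by
    have h1 := card_sdiff_add_card_inter S I
    have h2 := card_sdiff_add_card_inter I S
    rw [inter_comm] at h2
    omega
  have hd : ∑ u ∈ S \ I, f u ≤ ∑ u ∈ I \ S, f u := by
    calc ∑ u ∈ S \ I, f u ≤ (S \ I).card • (S \ I).sup f :=
          sum_le_card_nsmul _ _ _ fun u hu => le_sup (f := f) hu
      _ ≤ (I \ S).card • (S \ I).sup f := Nat.mul_le_mul_right _ hc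
      _ ≤ ∑ u ∈ I \ S, f u := by
          refine card_nsmul_le_sum _ _ _ fun u hu => Finset.sup_le fun v hv => ?_
          exact h u (mem_sdiff.mp hu).1 v (mem_sdiff.mp hv).2
  have h1 := sum_inter_add_sum_sdiff S I f
  have h2 := sum_inter_add_sum_sdiff I S f
  rw [inter_comm] at h2
  omega

/-- Degree sums over vertex sets, compared across majorized degree sequences. -/
lemma sum_deg_le_of_maj {n : ℕ} {π' π'' : Fin n → ℕ}
    (h' : IsTreeDegSeq π') (h'' : IsTreeDegSeq π'') (hmaj : Maj π' π'')
    {W : Type*} [Fintype V] [Fintype W] {T' : SimpleGraph V} {T'' : SimpleGraph W}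
    (hd' : hasDegSeq T' π') (hd'' : hasDegSeq T'' π'') (S' : Finset V) (S'' : Finset W)
    (hcard : S'.card ≤ S''.card)
    (hsort : ∀ u ∈ S'', ∀ v, v ∉ S'' → deg T'' v ≤ deg T'' u) :
    ∑ u ∈ S', deg T' u + S''.card ≤ ∑ u ∈ S'', deg T'' u + S'.card := by
  obtain ⟨e', he'⟩ := hd'
  obtain ⟨e'', he''⟩ := hd''
  set I : Finset (Fin n) := univ.filter (fun i : Fin n => (i : ℕ) < S'.card) with hI
  have hle : S'.card ≤ n := by
    have := card_le_univ S'
    rwa [Fintype.card_congr e', Fintype.card_fin] at this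
  have hIcard : I.card = S'.card := by
    rw [hI, Fin.card_filter_val_lt, min_eq_right hle]
  have hIprefix : ∀ u ∈ I, ∀ v, v ∉ I → u ≤ v := by
    intro u hu v hv
    simp only [hI, mem_filter, mem_univ, true_and] at hu hv
    exact Fin.le_def.mpr (by omega)
  have hstep' : ∑ u ∈ S', deg T' u ≤ ∑ i ∈ I, π' i := by
    calc ∑ u ∈ S', deg T' u = ∑ i ∈ S'.map e'.toEmbedding, π' i := by
          rw [sum_map]; exact sum_congr rfl fun u _ => he' u
      _ ≤ _ := sum_le_sum_of_dominating _ _ _ (by rw [card_map, hIcard])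
          fun u hu v hv => h'.2.1 u v (hIprefix u hu v hv)
  have hmid : ∑ i ∈ I, π' i ≤ ∑ i ∈ I, π'' i := by
    rcases hle.lt_or_eq with hlt | heq
    · exact hmaj.1 _ hlt
    · have : I = univ := by
        rw [← card_eq_iff_eq_univ, hIcard, heq, Fintype.card_fin]
      rw [this]
      exact hmaj.2.le
  have hpos : ∀ u, 1 ≤ deg T'' u := fun u => by rw [he'']; exact h''.1 _
  have hstep'' : ∑ i ∈ I, (π'' i - 1) ≤ ∑ u ∈ S'', (deg T'' u - 1) := by
    calc ∑ i ∈ I, (π'' i - 1) = ∑ u ∈ I.map e''.symm.toEmbedding, (deg T'' u - 1) := by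
          rw [sum_map]; exact sum_congr rfl fun i _ => by simp [he'']
      _ ≤ _ := sum_le_sum_of_dominating _ _ _ (by rw [card_map, hIcard]; exact hcard)
          fun u hu v hv => Nat.sub_le_sub_right (hsort u hu v hv) 1
  have e1 : ∑ i ∈ I, π'' i = ∑ i ∈ I, (π'' i - 1) + I.card := by
    rw [card_eq_sum_ones, ← sum_add_distrib]
    exact sum_congr rfl fun i _ => (Nat.sub_add_cancel (h''.1 i)).symm
  have e2 : ∑ u ∈ S'', deg T'' u = ∑ u ∈ S'', (deg T'' u - 1) + S''.card := by
    rw [card_eq_sum_ones, ← sum_add_distrib]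
    exact sum_congr rfl fun i _ => (Nat.sub_add_cancel (hpos i)).symm
  omega

/-- Balls in a tree grow no faster than degree-dominating balls in a tree whose degree sequence
majorizes that of the first. -/
lemma card_pairBall_le_of_maj {n : ℕ} {π' π'' : Fin n → ℕ}
    (h' : IsTreeDegSeq π') (h'' : IsTreeDegSeq π'') (hmaj : Maj π' π'')
    {W : Type*} [Fintype V] [Fintype W] {T' : SimpleGraph V} {T'' : SimpleGraph W}
    (hT' : T'.IsTree) (hT'' : T''.IsTree)
    (hd' : hasDegSeq T' π') (hd'' : hasDegSeq T'' π'') {c' e' : V} {c'' e'' : W}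
    (hce' : c' = e' ∨ T'.Adj c' e') (hce'' : c'' = e'' ∨ T''.Adj c'' e'')
    (hsort : ∀ i, ∀ u ∈ pairBall T'' c'' e'' i, ∀ v, v ∉ pairBall T'' c'' e'' i →
      deg T'' v ≤ deg T'' u)
    (hzero : (pairBall T' c' e' 0).card ≤ (pairBall T'' c'' e'' 0).card) (i : ℕ) :
    (pairBall T' c' e' i).card ≤ (pairBall T'' c'' e'' i).card := by
  induction i with
  | zero => exact hzero
  | succ i ih =>
    have h1 := card_pairBall_succ hT' hce' i
    have h2 := card_pairBall_succ hT'' hce'' i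
    have h3 := sum_deg_le_of_maj h' h'' hmaj hd' hd'' _ _ ih (hsort i)
    omega

lemma card_pairBall_zero [Fintype V] [DecidableEq V] {T : SimpleGraph V} (hT : T.Connected)
    (c e : V) : (pairBall T c e 0).card = if c = e then 1 else 2 := by
  have : pairBall T c e 0 = {c, e} := by
    ext u
    simp only [mem_pairBall, Nat.le_zero, hT.dist_eq_zero_iff, mem_insert, mem_singleton]
    rw [eq_comm, @eq_comm _ e]
  rw [this]
  split_ifs with h
  · simp [h]
  · exact card_pair h

lemma dist_le_ecc [Fintype V] (T : SimpleGraph V) (u v : V) : T.dist u v ≤ ecc T u :=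
  Finset.le_sup (f := fun v => T.dist u v) (mem_univ v)

/-- Vertices near a pair of vertices that covers the tree have small eccentricity. -/
lemma ecc_le_of_mem_pairBall [Fintype V] {T : SimpleGraph V} (hT : T.Connected) {c e : V}
    {j k : ℕ} (hk : pairBall T c e k = univ) {u : V} (hu : u ∈ pairBall T c e j) :
    ecc T u ≤ j + T.dist c e + k := by
  refine Finset.sup_le fun w _ => ?_
  have hw : w ∈ pairBall T c e k := hk ▸ mem_univ w
  rw [mem_pairBall, dist_comm, dist_comm (u := e)] at hu
  rw [mem_pairBall] at hw
  have h1 := hT.dist_triangle (u := u) (v := c) (w := w)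
  have h2 := hT.dist_triangle (u := u) (v := e) (w := w)
  have h3 := hT.dist_triangle (u := c) (v := e) (w := w)
  have h4 := hT.dist_triangle (u := e) (v := c) (w := w)
  rw [dist_comm (u := e) (v := c)] at h4
  rcases hu with hu | hu <;> rcases hw with hw | hw <;> omega

/-- Every tree has a central vertex or a central edge: the eccentricity of a vertex is bounded
below by its distance to the center plus the radius. -/
lemma exists_center [Fintype V] {T : SimpleGraph V} (hT : T.IsTree) :
    ∃ c e k, (c = e ∨ T.Adj c e) ∧ pairBall T c e k = univ ∧
      ∀ u, ∃ j, u ∈ pairBall T c e j ∧ j + T.dist c e + k ≤ ecc T u := by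
  have := hT.connected.nonempty
  obtain ⟨⟨x, y⟩, -, hmax⟩ := exists_max_image (univ : Finset (V × V))
    (fun z => T.dist z.1 z.2) univ_nonempty
  have hmax : ∀ u v, T.dist u v ≤ T.dist x y := fun u v => hmax (u, v) (mem_univ _)
  have hmaxe : ∀ u, ecc T u ≤ T.dist x y := fun u => Finset.sup_le fun v _ => hmax u v
  have hgeo : ∀ d ≤ T.dist x y, ∃ c, T.dist x c = d ∧ T.dist c y + d = T.dist x y := by
    intro d
    induction d with
    | zero => intro _; exact ⟨x, by simp⟩
    | succ d ih =>
      intro hd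
      obtain ⟨c, hc, hcy⟩ := ih (by omega)
      have hne : c ≠ y := by rintro rfl; simp at hcy; omega
      obtain ⟨p, hp, hpd⟩ := exists_parent hT.connected hne
      have h1 := hT.connected.dist_triangle (u := x) (v := c) (w := p)
      have h2 := hT.connected.dist_triangle (u := x) (v := p) (w := y)
      rw [dist_eq_one_iff_adj.mpr hp.symm] at h1
      rw [dist_comm (u := y), dist_comm (u := y)] at hpd
      exact ⟨p, by omega, by omega⟩
  -- `c` and its predecessor `e` on a geodesic from `x` to `y`
  have hedge : ∀ d, d + 1 ≤ T.dist x y → ∃ c e, T.Adj c e ∧ T.dist x e = d ∧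
      T.dist x c = d + 1 ∧ T.dist c y + (d + 1) = T.dist x y ∧ T.dist e y + d = T.dist x y := by
    intro d hd
    obtain ⟨c, hc, hcy⟩ := hgeo (d + 1) hd
    have hne : c ≠ x := by rintro rfl; simp at hc
    obtain ⟨e, he, hed⟩ := exists_parent hT.connected hne
    have h1 := hT.connected.dist_triangle (u := x) (v := e) (w := y)
    have h2 := hT.connected.dist_triangle (u := e) (v := c) (w := y)
    rw [dist_eq_one_iff_adj.mpr he] at h2
    exact ⟨c, e, he.symm, by omega, hc, hcy, by omega⟩
  have hfar : ∀ {c e d}, T.Adj c e → T.dist x e = d → T.dist x c = d + 1 →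
      T.dist c y + (d + 1) = T.dist x y → T.dist e y + d = T.dist x y → ∀ u,
      (T.dist u c = T.dist u e + 1 ∧ T.dist u y = T.dist u e + 1 + T.dist c y) ∨
      (T.dist u e = T.dist u c + 1 ∧ T.dist u x = T.dist u c + 1 + T.dist x e) := by
    intro c e d hce he hc hcy hey u
    rcases hT.dist_eq_dist_add_one_of_adj u hce with h | h
    · left
      refine ⟨h, dist_across_edge hT hce h y ?_⟩
      rw [dist_comm, dist_comm (u := y) (v := c)]
      omega
    · right
      refine ⟨h, ?_⟩
      rw [dist_comm (u := x) (v := e)]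
      exact dist_across_edge hT hce.symm h x (by omega)
  rcases Nat.even_or_odd' (T.dist x y) with ⟨k, hk | hk⟩
  · cases k with
    | zero =>
      have hx : ∀ u, T.dist x u = 0 := fun u => by have := hmax x u; omega
      refine ⟨x, x, 0, Or.inl rfl, ?_, fun u => ⟨0, ?_, by simp⟩⟩
      · ext u; simp only [mem_pairBall, mem_univ, hx]; simp
      · simp only [mem_pairBall, hx]; simp
    | succ d =>
      obtain ⟨c, e, hce, he, hc, hcy, hey⟩ := hedge d (by omega)
      have key : ∀ u, T.dist c u + (d + 1) ≤ ecc T u := by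
        intro u
        have hx := dist_le_ecc T u x
        have hy := dist_le_ecc T u y
        rw [dist_comm (u := c)]
        rcases hfar hce he hc hcy hey u with h | h <;> omega
      refine ⟨c, c, d + 1, Or.inl rfl, ?_, fun u => ⟨T.dist c u, ?_, by simpa using key u⟩⟩
      · ext u
        have := key u
        have := hmaxe u
        simp only [mem_pairBall, mem_univ, iff_true]
        omega
      · simp [mem_pairBall]
  · obtain ⟨c, e, hce, he, hc, hcy, hey⟩ := hedge k (by omega)
    have key : ∀ u, ∃ j, (T.dist c u ≤ j ∨ T.dist e u ≤ j) ∧ j + 1 + k ≤ ecc T u := by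
      intro u
      have hx := dist_le_ecc T u x
      have hy := dist_le_ecc T u y
      rw [dist_comm (u := c), dist_comm (u := e)]
      rcases hfar hce he hc hcy hey u with h | h
      · exact ⟨T.dist u e, Or.inr le_rfl, by omega⟩
      · exact ⟨T.dist u c, Or.inl le_rfl, by omega⟩
    refine ⟨c, e, k, Or.inr hce, ?_, fun u => ?_⟩
    · ext u
      obtain ⟨j, hj, hj'⟩ := key u
      have := hmaxe u
      simp only [mem_pairBall, mem_univ, iff_true]
      omega
    · obtain ⟨j, hj, hj'⟩ := key u
      exact ⟨j, mem_pairBall.mpr hj, by rwa [dist_eq_one_iff_adj.mpr hce]⟩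

/-- In a greedy tree, degrees weakly decrease with the distance to the root. -/
lemma deg_le_of_dist_lt [Fintype V] {T : SimpleGraph V} {r : V} (hT : T.Connected)
    (hg : IsGreedyTree T r) {u v : V} (h : T.dist r u < T.dist r v) : deg T v ≤ deg T u := by
  induction hk : T.dist r v generalizing v with
  | zero => omega
  | succ k ih =>
    have hne : v ≠ r := by rintro rfl; simp at hk
    obtain ⟨p, hp, hpd⟩ := exists_parent hT hne
    rcases (show T.dist r u ≤ T.dist r p by omega).lt_or_eq with hlt | heq
    · exact (hg.2.2 v p hpd).trans (ih hlt (by omega))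
    · exact hg.2.2 v u (by omega)

lemma deg_dominating_ball [Fintype V] {T : SimpleGraph V} {r : V} (hT : T.Connected)
    (hg : IsGreedyTree T r) (i : ℕ) : ∀ u ∈ pairBall T r r i, ∀ v, v ∉ pairBall T r r i →
      deg T v ≤ deg T u := by
  intro u hu v hv
  simp only [mem_pairBall, or_self] at hu hv
  exact deg_le_of_dist_lt hT hg (by omega)

/-- In a greedy tree, the edge from the root to its first child has degree-dominating balls. -/
lemma exists_deg_dominating_edge [Fintype V] [Nontrivial V] {T : SimpleGraph V} {r : V}
    (hT : T.IsTree) (hg : IsGreedyTree T r) :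
    ∃ e, T.Adj r e ∧ ∀ i, ∀ u ∈ pairBall T r e i, ∀ v, v ∉ pairBall T r e i →
      deg T v ≤ deg T u := by
  classical
  obtain ⟨ord, hinj, hmono, hlevel⟩ := hg.1
  obtain ⟨w, hw⟩ := exists_ne r
  obtain ⟨P, hP⟩ := hT.connected.exists_walk_length_eq_dist r w
  have hnbr : (univ.filter (fun v => T.Adj r v)).Nonempty := by
    cases P with
    | nil => exact absurd rfl hw
    | @cons _ p _ hadj P => exact ⟨p, by simpa using hadj⟩
  obtain ⟨e, he, hmin⟩ := exists_min_image _ ord hnbr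
  simp only [mem_filter, mem_univ, true_and] at he hmin
  have hre := dist_eq_one_iff_adj.mpr he
  have hside : ∀ a, T.dist r a = T.dist e a + 1 ∨ T.dist e a = T.dist r a + 1 := by
    intro a
    rw [dist_comm, dist_comm (u := e)]
    exact hT.dist_eq_dist_add_one_of_adj a he
  have hord : ∀ j u v, T.dist r u = j + 1 → T.dist e u = j → T.dist r v = j + 1 →
      T.dist e v = j + 2 → ord u < ord v := by
    intro j
    induction j with
    | zero =>
      intro u v hu hu' hv hv'
      rw [hT.connected.dist_eq_zero_iff] at hu'
      subst hu'
      refine lt_of_le_of_ne (hmin v (dist_eq_one_iff_adj.mp hv)) fun h => ?_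
      have := hinj e v (by omega) h
      subst this
      simp at hv'
    | succ j ih =>
      intro u v hu hu' hv hv'
      have hue : u ≠ e := by rintro rfl; simp at hu'
      have hvr : v ≠ r := by rintro rfl; simp at hv
      obtain ⟨p, hp, hpd⟩ := exists_parent hT.connected hue
      obtain ⟨q, hq, hqd⟩ := exists_parent hT.connected hvr
      have hp1 := hT.connected.dist_triangle (u := r) (v := p) (w := u)
      have hq1 := hT.connected.dist_triangle (u := e) (v := q) (w := v)
      rw [dist_eq_one_iff_adj.mpr hp] at hp1
      rw [dist_eq_one_iff_adj.mpr hq] at hq1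
      have hp2 := hside p
      have hq2 := hside q
      exact hlevel p q u v (by omega) hp (by omega) hq hqd
        (ih p q (by omega) (by omega) (by omega) (by omega))
  refine ⟨e, he, fun i u hu v hv => ?_⟩
  rw [mem_pairBall] at hu hv
  have hu2 := hside u
  have hv2 := hside v
  by_cases hlt : T.dist r u < T.dist r v
  · exact deg_le_of_dist_lt hT.connected hg hlt
  · exact hmono u v (by omega) (hord i u v (by omega) (by omega) (by omega) (by omega)).le

/-- Degree sums over vertices of bounded eccentricity increase under majorization towards a greedy
tree. -/
lemma sum_deg_ecc_le_of_maj {n : ℕ} {π' π'' : Fin n → ℕ}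
    (h' : IsTreeDegSeq π') (h'' : IsTreeDegSeq π'') (hmaj : Maj π' π'')
    {W : Type*} [Fintype V] [Fintype W] [Nontrivial W] {T' : SimpleGraph V} {T'' : SimpleGraph W}
    {r : W} (hT' : T'.IsTree) (hT'' : T''.IsTree)
    (hd' : hasDegSeq T' π') (hd'' : hasDegSeq T'' π'') (hg : IsGreedyTree T'' r) (m : ℕ) :
    ∑ u ∈ univ.filter (fun u => ecc T' u ≤ m), deg T' u ≤
      ∑ u ∈ univ.filter (fun u => ecc T'' u ≤ m), deg T'' u := by
  classical
  obtain ⟨c', e', k, hce', hk, hecc⟩ := exists_center hT'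
  obtain ⟨c'', e'', hce'', hdist, hzero, hsort⟩ : ∃ c'' e'', (c'' = e'' ∨ T''.Adj c'' e'') ∧
      T''.dist c'' e'' = T'.dist c' e' ∧
      (pairBall T' c' e' 0).card ≤ (pairBall T'' c'' e'' 0).card ∧
      ∀ i, ∀ u ∈ pairBall T'' c'' e'' i, ∀ v, v ∉ pairBall T'' c'' e'' i →
        deg T'' v ≤ deg T'' u := by
    simp only [card_pairBall_zero hT'.connected, card_pairBall_zero hT''.connected]
    rcases hce' with rfl | hce'
    · exact ⟨r, r, Or.inl rfl, by simp, by simp, deg_dominating_ball hT''.connected hg⟩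
    · obtain ⟨e, he, hs⟩ := exists_deg_dominating_edge hT'' hg
      exact ⟨r, e, Or.inr he, by rw [dist_eq_one_iff_adj.mpr he, dist_eq_one_iff_adj.mpr hce'],
        by simp [he.ne, hce'.ne], hs⟩
  have hcard := card_pairBall_le_of_maj h' h'' hmaj hT' hT'' hd' hd'' hce' hce'' hsort hzero
  have hVW : Fintype.card V = Fintype.card W := by
    obtain ⟨f', -⟩ := hd'
    obtain ⟨f'', -⟩ := hd''
    rw [Fintype.card_congr f', Fintype.card_congr f'']
  have hk'' : pairBall T'' c'' e'' k = univ := by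
    rw [← card_eq_iff_eq_univ]
    refine le_antisymm (card_le_univ _) ?_
    rw [← hVW, ← card_univ, ← hk]
    exact hcard k
  by_cases hm : T'.dist c' e' + k ≤ m
  · obtain ⟨j, rfl⟩ := Nat.exists_eq_add_of_le hm
    have hsub' : univ.filter (fun u => ecc T' u ≤ T'.dist c' e' + k + j) ⊆ pairBall T' c' e' j := by
      intro u hu
      obtain ⟨i, hi, hi'⟩ := hecc u
      simp only [mem_filter, mem_univ, true_and] at hu
      rw [mem_pairBall] at hi ⊢
      omega
    have hsub'' : pairBall T'' c'' e'' j ⊆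
        univ.filter (fun u => ecc T'' u ≤ T'.dist c' e' + k + j) := by
      intro u hu
      have := ecc_le_of_mem_pairBall hT''.connected hk'' hu
      simp only [mem_filter, mem_univ, true_and]
      omega
    have h1 := sum_deg_le_of_maj h' h'' hmaj hd' hd'' _ _ (hcard j) (hsort j)
    have h2 := sum_le_sum_of_subset (f := deg T') hsub'
    have h3 := sum_le_sum_of_subset (f := deg T'') hsub''
    have h4 := hcard j
    omega
  · rw [filter_eq_empty_iff.mpr]
    · simp
    · intro u _ hu
      obtain ⟨i, -, hi⟩ := hecc u
      omega

/-- Abel summation for the connective eccentricity index. -/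
lemma cei_eq_sum [Fintype V] [Nontrivial V] {T : SimpleGraph V} (hT : T.Connected) {M : ℕ}
    (hM : ∀ u, ecc T u ≤ M) :
    cei T = ((∑ u, deg T u : ℕ) : ℝ) / M + ∑ m ∈ Finset.Ico 1 M, ((1 : ℝ) / m - 1 / (m + 1 : ℕ)) *
      ((∑ u ∈ univ.filter (fun u => ecc T u ≤ m), deg T u : ℕ) : ℝ) := by
  have hpos : ∀ u, 1 ≤ ecc T u := by
    intro u
    obtain ⟨w, hw⟩ := exists_ne u
    exact (hT.pos_dist_of_ne hw.symm).trans_le (dist_le_ecc T u w)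
  have htel : ∀ u, (1 : ℝ) / ecc T u = 1 / M + ∑ m ∈ Finset.Ico 1 M,
      ((1 : ℝ) / m - 1 / (m + 1 : ℕ)) * (if ecc T u ≤ m then 1 else 0) := by
    intro u
    have hf : (Finset.Ico 1 M).filter (fun m => ecc T u ≤ m) = Finset.Ico (ecc T u) M := by
      ext m
      have := hpos u
      simp only [mem_filter, Finset.mem_Ico]
      omega
    simp only [mul_ite, mul_one, mul_zero]
    rw [← sum_filter, hf]
    have := sum_Ico_sub (fun m : ℕ => (1 : ℝ) / m) (hM u)
    have h2 : ∑ m ∈ Finset.Ico (ecc T u) M, ((1 : ℝ) / m - 1 / (m + 1 : ℕ)) =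
        -∑ m ∈ Finset.Ico (ecc T u) M, ((1 : ℝ) / (m + 1 : ℕ) - 1 / m) := by
      rw [← sum_neg_distrib]
      exact sum_congr rfl fun m _ => by ring
    rw [h2, this]
    ring
  unfold cei
  calc ∑ u, (deg T u : ℝ) / ecc T u
      = ∑ u, ((deg T u : ℝ) / M + ∑ m ∈ Finset.Ico 1 M,
        ((1 : ℝ) / m - 1 / (m + 1 : ℕ)) * (if ecc T u ≤ m then (deg T u : ℝ) else 0)) := by
        refine sum_congr rfl fun u _ => ?_
        rw [div_eq_mul_one_div, htel u, mul_add, mul_sum]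
        congr 1
        · ring
        · refine sum_congr rfl fun m _ => ?_
          split_ifs <;> ring
    _ = _ := by
        rw [sum_add_distrib, sum_comm]
        congr 1
        · rw [Nat.cast_sum, sum_div]
        · refine sum_congr rfl fun m _ => ?_
          rw [Nat.cast_sum, sum_filter, mul_sum]

/-- if `π' ◁ π''` are non-increasing tree degree sequences, then the
connective eccentricity index of the greedy tree for `π'` is at most that of the
greedy tree for `π''`. -/
theorem cei_greedyTree_mono_of_maj {n : ℕ} (π' π'' : Fin n → ℕ)
    (h' : IsTreeDegSeq π') (h'' : IsTreeDegSeq π'') (hmaj : Maj π' π'')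
    {W : Type*} [Fintype V] [Fintype W]
    (T' : SimpleGraph V) (r' : V) (hT' : T'.IsTree)
    (hd' : hasDegSeq T' π') (hg' : IsGreedyTree T' r')
    (T'' : SimpleGraph W) (r'' : W) (hT'' : T''.IsTree)
    (hd'' : hasDegSeq T'' π'') (hg'' : IsGreedyTree T'' r'') :
    cei T' ≤ cei T'' := by
  obtain ⟨e', he'⟩ := id hd'
  obtain ⟨e'', he''⟩ := id hd''
  have hn : 1 < n := by
    have hlt := (e' r').isLt
    have hle := Finset.single_le_sum (fun i _ => Nat.zero_le (π' i)) (mem_univ (e' r'))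
    have hone := h'.1 (e' r')
    rw [h'.2.2] at hle
    omega
  have : Nontrivial V := by
    rw [← Fintype.one_lt_card_iff_nontrivial, Fintype.card_congr e', Fintype.card_fin]
    exact hn
  have : Nontrivial W := by
    rw [← Fintype.one_lt_card_iff_nontrivial, Fintype.card_congr e'', Fintype.card_fin]
    exact hn
  have hsum' : ∑ u, deg T' u = 2 * (n - 1) := by
    rw [← h'.2.2, ← e'.sum_comp]
    exact sum_congr rfl fun u _ => he' u
  have hsum'' : ∑ u, deg T'' u = 2 * (n - 1) := by
    rw [← h''.2.2, ← e''.sum_comp]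
    exact sum_congr rfl fun u _ => he'' u
  have hM' : ∀ u, ecc T' u ≤ max (univ.sup (ecc T')) (univ.sup (ecc T'')) :=
    fun u => le_max_of_le_left (Finset.le_sup (mem_univ u))
  have hM'' : ∀ u, ecc T'' u ≤ max (univ.sup (ecc T')) (univ.sup (ecc T'')) :=
    fun u => le_max_of_le_right (Finset.le_sup (mem_univ u))
  rw [cei_eq_sum hT'.connected hM', cei_eq_sum hT''.connected hM'', hsum', hsum'']
  refine add_le_add le_rfl (sum_le_sum fun m hm => mul_le_mul_of_nonneg_left ?_ ?_)
  · exact_mod_cast sum_deg_ecc_le_of_maj h' h'' hmaj hT' hT'' hd' hd'' hg'' m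
  · have hm1 : 1 ≤ m := (Finset.mem_Ico.mp hm).1
    rw [sub_nonneg]
    exact one_div_le_one_div_of_le (by exact_mod_cast hm1) (by push_cast; linarith)
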